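/- arXiv:2106.12653 — 3 statements merged into one kernel-verified Lean document; each statement's English description precedes it below -/
import Mathlib

section
/- Let Ω ⊂ ℝ^d be a measurable set of finite Lebesgue measure, ν > 0, φ : Ω → ℝ measurable with φ(x) ≥ ν for a.e. x ∈ Ω, and 2 ≤ 2q ≤ p < ∞. Let X be a real Banach space and let D : X → L^p(Ω; ℝ^d) be a bounded linear operator. With P and G_P as follows: for x ∈ Ω, P_x(a) = (|a| − φ(x))^± · a/|a| for a ≠ 0, P_x(0) = 0, (P(v))(x) = P_x(v(x)), and for v(x) ≠ 0, (G_P(v)h)(x) = χ_{(0,1)}(|v(x)| − φ(x)) · (v(x)·h(x)/|v(x)|²) v(x) + (|v(x)| − φ(x))^± · (1/|v(x)|)( h(x) − (v(x)·h(x)/|v(x)|²) v(x) ), with (G_P(v)h)(x) = 0 where v(x) = 0. Then the map u ↦ P(D u) from X to L^q(Ω; ℝ^d) is Newton differentiable, with Newton derivative u ↦ (h ↦ G_P(D u)(D h)); that is, for every u ∈ X, ‖P(D(u+h)) − P(D u) − G_P(D(u+h))(D h)‖_{L^q} / ‖h‖_X → 0 as ‖h‖_X → 0. -/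
open MeasureTheory RealInnerProductSpace Classical
open scoped ENNReal

/-- The pointwise regularization vector field `P_x(a) = (|a| − φ(x))^± a/|a|`
(and `P_x(0) = 0`), where `t^± = min(1, max(0, t))`; here `φx = φ(x)`. -/
noncomputable def Pvec {d : ℕ} (φx : ℝ) (a : EuclideanSpace ℝ (Fin d)) :
    EuclideanSpace ℝ (Fin d) :=
  if a = 0 then 0 else (min 1 (max 0 (‖a‖ - φx))) • (‖a‖⁻¹ • a)

/-- The pointwise Newton derivative of `P_x`: for `a ≠ 0`,
`χ_{(0,1)}(|a| − φx) (a·h/|a|²) a + (|a| − φx)^± (1/|a|)(h − (a·h/|a|²) a)`,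
and `0` for `a = 0`. -/
noncomputable def GPvec {d : ℕ} (φx : ℝ) (a h : EuclideanSpace ℝ (Fin d)) :
    EuclideanSpace ℝ (Fin d) :=
  if a = 0 then 0 else
    (Set.indicator (Set.Ioo (0 : ℝ) 1) (fun _ => (1 : ℝ)) (‖a‖ - φx)) •
        ((⟪a, h⟫ / ‖a‖ ^ 2) • a) +
      (min 1 (max 0 (‖a‖ - φx))) • (‖a‖⁻¹ • (h - (⟪a, h⟫ / ‖a‖ ^ 2) • a))

section Pointwise

variable {E : Type*} [NormedAddCommGroup E] [InnerProductSpace ℝ E]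

theorem norm_norm_inv_smul_le_one (a : E) : ‖‖a‖⁻¹ • a‖ ≤ 1 := by
  rw [norm_smul, norm_inv, norm_norm]
  exact inv_mul_le_one

theorem norm_norm_inv_smul_sub_le (a : E) {b : E} (hb : b ≠ 0) :
    ‖‖b‖⁻¹ • b - ‖a‖⁻¹ • a‖ ≤ 2 * ‖b - a‖ / ‖b‖ := by
  have hβ : 0 < ‖b‖ := norm_pos_iff.2 hb
  have key : ‖b‖⁻¹ • b - ‖a‖⁻¹ • a =
      ‖b‖⁻¹ • ((b - a) + (‖a‖ - ‖b‖) • (‖a‖⁻¹ • a)) := by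
    rcases eq_or_ne a 0 with rfl | ha
    · simp
    · have hα : ‖a‖ ≠ 0 := norm_ne_zero_iff.2 ha
      match_scalars <;> field_simp
      ring
  rw [key, norm_smul, norm_inv, norm_norm, inv_mul_eq_div]
  gcongr
  refine (norm_add_le _ _).trans ?_
  rw [norm_smul, two_mul]
  gcongr
  calc ‖‖a‖ - ‖b‖‖ * ‖‖a‖⁻¹ • a‖ ≤ ‖b - a‖ * 1 := by
        gcongr
        · rw [norm_sub_rev b a]; exact abs_norm_sub_norm_le a b
        · exact norm_norm_inv_smul_le_one a
    _ = ‖b - a‖ := mul_one _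

/-- Half of `‖b - a‖²` dominates the defect in the Cauchy-Schwarz inequality. -/
theorem norm_mul_norm_sub_inner_le (a b : E) :
    ‖a‖ * ‖b‖ - ⟪b, a⟫ ≤ ‖b - a‖ ^ 2 / 2 := by
  rw [norm_sub_sq_real]
  nlinarith [sq_nonneg (‖a‖ - ‖b‖)]

/-- Splitting of the Newton remainder of `b ↦ m(‖b‖) • b / ‖b‖`, with `m` and `m'` standing for the
value and the slope of the radial profile at `‖b‖` and `m₀` for its value at `‖a‖`. -/
theorem radial_remainder_eq (m m₀ m' : ℝ) (a : E) {b : E} (hb : b ≠ 0) :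
    m • (‖b‖⁻¹ • b) - m₀ • (‖a‖⁻¹ • a) -
      (m' • ((⟪b, b - a⟫ / ‖b‖ ^ 2) • b) +
        m • (‖b‖⁻¹ • ((b - a) - (⟪b, b - a⟫ / ‖b‖ ^ 2) • b))) =
    (m * ((‖b‖ - ‖a‖) / ‖b‖) - m' * (‖b‖ - ‖a‖)) • (‖b‖⁻¹ • b - ‖a‖⁻¹ • a) +
      ((m / ‖b‖ ^ 2 - m' / ‖b‖) * (‖a‖ * ‖b‖ - ⟪b, a⟫)) • (‖b‖⁻¹ • b) +
      (m - m₀ - m' * (‖b‖ - ‖a‖)) • (‖a‖⁻¹ • a) := by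
  have hβ : ‖b‖ ≠ 0 := norm_ne_zero_iff.2 hb
  rw [inner_sub_right, real_inner_self_eq_norm_sq]
  rcases eq_or_ne a 0 with rfl | ha
  · simp only [inner_zero_right, norm_zero, smul_zero]
    match_scalars
    field_simp
    ring
  · have hα : ‖a‖ ≠ 0 := norm_ne_zero_iff.2 ha
    match_scalars <;> field_simp <;> ring

/-- Quadratic bound for the Newton remainder of a radial field, provided the radial profile has
no remainder of its own. -/
theorem norm_radial_remainder_le {ν m m₀ m' : ℝ} {a b : E} (hν : 0 < ν) (hb : ν ≤ ‖b‖)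
    (hm : |m| ≤ 1) (hm' : |m'| ≤ 1) (he : m - m₀ - m' * (‖b‖ - ‖a‖) = 0) :
    ‖m • (‖b‖⁻¹ • b) - m₀ • (‖a‖⁻¹ • a) -
      (m' • ((⟪b, b - a⟫ / ‖b‖ ^ 2) • b) +
        m • (‖b‖⁻¹ • ((b - a) - (⟪b, b - a⟫ / ‖b‖ ^ 2) • b)))‖ ≤
      3 * (1 / ν ^ 2 + 1 / ν) * ‖b - a‖ ^ 2 := by
  have hβ : 0 < ‖b‖ := hν.trans_le hb
  have hb0 : b ≠ 0 := norm_pos_iff.1 hβ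
  rw [radial_remainder_eq m m₀ m' a hb0, he, zero_smul, add_zero]
  refine (norm_add_le _ _).trans ?_
  rw [norm_smul, norm_smul]
  set t := ‖b - a‖ with ht
  have ht0 : 0 ≤ t := norm_nonneg _
  have hd : |‖b‖ - ‖a‖| ≤ t := abs_norm_sub_norm_le b a
  have hs0 : 0 ≤ ‖a‖ * ‖b‖ - ⟪b, a⟫ := by
    have := real_inner_le_norm b a
    linarith
  have hs := norm_mul_norm_sub_inner_le a b
  have h1 : ‖m * ((‖b‖ - ‖a‖) / ‖b‖) - m' * (‖b‖ - ‖a‖)‖ ≤ t / ‖b‖ + t := by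
    refine (norm_sub_le _ _).trans ?_
    rw [Real.norm_eq_abs, Real.norm_eq_abs, abs_mul, abs_mul, abs_div, abs_of_pos hβ]
    refine add_le_add ?_ ?_
    · calc |m| * (|‖b‖ - ‖a‖| / ‖b‖) ≤ 1 * (t / ‖b‖) := by gcongr
        _ = t / ‖b‖ := one_mul _
    · calc |m'| * |‖b‖ - ‖a‖| ≤ 1 * t := by gcongr
        _ = t := one_mul _
  have h2 : ‖(m / ‖b‖ ^ 2 - m' / ‖b‖) * (‖a‖ * ‖b‖ - ⟪b, a⟫)‖ ≤
      (1 / ‖b‖ ^ 2 + 1 / ‖b‖) * (t ^ 2 / 2) := by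
    rw [Real.norm_eq_abs, abs_mul, abs_of_nonneg hs0]
    gcongr
    refine (abs_sub _ _).trans ?_
    rw [abs_div, abs_div, abs_of_pos hβ, abs_of_pos (pow_pos hβ 2)]
    gcongr
  calc ‖m * ((‖b‖ - ‖a‖) / ‖b‖) - m' * (‖b‖ - ‖a‖)‖ * ‖‖b‖⁻¹ • b - ‖a‖⁻¹ • a‖ +
        ‖(m / ‖b‖ ^ 2 - m' / ‖b‖) * (‖a‖ * ‖b‖ - ⟪b, a⟫)‖ * ‖‖b‖⁻¹ • b‖
      ≤ (t / ‖b‖ + t) * (2 * t / ‖b‖) + (1 / ‖b‖ ^ 2 + 1 / ‖b‖) * (t ^ 2 / 2) * 1 := by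
        gcongr
        · exact norm_norm_inv_smul_sub_le a hb0
        · exact norm_norm_inv_smul_le_one b
    _ = 5 / 2 * (1 / ‖b‖ ^ 2 + 1 / ‖b‖) * t ^ 2 := by field_simp; ring
    _ ≤ 3 * (1 / ν ^ 2 + 1 / ν) * t ^ 2 := by gcongr; norm_num

end Pointwise

section Ramp

/-- The ramp `t ↦ min 1 (max 0 t)` has vanishing Newton remainder near every point. -/
theorem eventually_ramp_remainder_eq_zero (s : ℝ) :
    ∀ᶠ t in nhds s, min 1 (max 0 t) - min 1 (max 0 s) -
      (Set.Ioo (0 : ℝ) 1).indicator (fun _ => (1 : ℝ)) t * (t - s) = 0 := by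
  have aux : ∀ t : ℝ, (s < 0 → t < 0) → (0 < s → 0 < t) → (s < 1 → t < 1) → (1 < s → 1 < t) →
      min 1 (max 0 t) - min 1 (max 0 s) -
        (Set.Ioo (0 : ℝ) 1).indicator (fun _ => (1 : ℝ)) t * (t - s) = 0 := by
    intro t h1 h2 h3 h4
    by_cases ht : t ∈ Set.Ioo (0 : ℝ) 1
    · rw [Set.indicator_of_mem ht]
      have hs0 : 0 ≤ s := not_lt.1 fun h => (h1 h).not_gt ht.1
      have hs1 : s ≤ 1 := not_lt.1 fun h => (h4 h).not_gt ht.2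
      rw [max_eq_right ht.1.le, max_eq_right hs0, min_eq_right ht.2.le, min_eq_right hs1]
      ring
    · rw [Set.indicator_of_notMem ht]
      rcases le_or_gt t 0 with h | h
      · have hs0 : s ≤ 0 := not_lt.1 fun h' => (h2 h').not_ge h
        simp [h, hs0]
      · have h' : 1 ≤ t := not_lt.1 fun h' => ht ⟨h, h'⟩
        have hs1 : 1 ≤ s := not_lt.1 fun h'' => (h3 h'').not_ge h'
        rw [max_eq_right h.le, max_eq_right (zero_le_one.trans hs1), min_eq_left h',
          min_eq_left hs1]
        ring
  have ev : ∀ {p : Prop} {q : ℝ → Prop}, (p → ∀ᶠ t in nhds s, q t) →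
      ∀ᶠ t in nhds s, p → q t := by
    intro p q h
    by_cases hp : p
    · simpa [hp] using h hp
    · simp [hp]
  filter_upwards [ev fun h : s < 0 => Iio_mem_nhds h, ev fun h : 0 < s => Ioi_mem_nhds h,
    ev fun h : s < 1 => Iio_mem_nhds h, ev fun h : 1 < s => Ioi_mem_nhds h] with t h1 h2 h3 h4
  exact aux t h1 h2 h3 h4

theorem abs_ramp_le_one (t : ℝ) : |min 1 (max 0 t)| ≤ 1 := by
  rw [abs_of_nonneg (le_min zero_le_one (le_max_left _ _))]
  exact min_le_left _ _

theorem abs_ramp_sub_ramp_le (s t : ℝ) :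
    |min 1 (max 0 t) - min 1 (max 0 s)| ≤ |t - s| :=
  calc |min 1 (max 0 t) - min 1 (max 0 s)| ≤ |max 0 t - max 0 s| := by
        simpa using abs_min_sub_min_le_max 1 (max 0 t) 1 (max 0 s)
    _ ≤ |t - s| := by simpa using abs_max_sub_max_le_max 0 t 0 s

theorem ramp_eq_zero_of_nonpos {t : ℝ} (ht : t ≤ 0) : min 1 (max 0 t) = 0 := by
  simp [ht]

end Ramp

section Field

variable {d : ℕ}

local notation "V" => EuclideanSpace ℝ (Fin d)

theorem Pvec_eq (φx : ℝ) (a : V) :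
    Pvec φx a = (min 1 (max 0 (‖a‖ - φx))) • (‖a‖⁻¹ • a) := by
  unfold Pvec
  split_ifs with h <;> simp [h]

theorem GPvec_eq (φx : ℝ) (a h : V) :
    GPvec φx a h = (Set.indicator (Set.Ioo (0 : ℝ) 1) (fun _ => (1 : ℝ)) (‖a‖ - φx)) •
        ((⟪a, h⟫ / ‖a‖ ^ 2) • a) +
      (min 1 (max 0 (‖a‖ - φx))) • (‖a‖⁻¹ • (h - (⟪a, h⟫ / ‖a‖ ^ 2) • a)) := by
  unfold GPvec
  split_ifs with h <;> simp [h]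

theorem GPvec_add (φx : ℝ) (a h k : V) :
    GPvec φx a (h + k) = GPvec φx a h + GPvec φx a k := by
  simp only [GPvec_eq, inner_add_right]
  module

theorem GPvec_smul (φx : ℝ) (a : V) (c : ℝ) (h : V) :
    GPvec φx a (c • h) = c • GPvec φx a h := by
  simp only [GPvec_eq, inner_smul_right]
  module

theorem norm_Pvec_le_one (φx : ℝ) (a : V) : ‖Pvec φx a‖ ≤ 1 := by
  rw [Pvec_eq, norm_smul, Real.norm_eq_abs]
  exact mul_le_one₀ (abs_ramp_le_one _) (norm_nonneg _) (norm_norm_inv_smul_le_one a)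

theorem Pvec_eq_zero {φx : ℝ} {a : V} (h : ‖a‖ ≤ φx) : Pvec φx a = 0 := by
  rw [Pvec_eq, ramp_eq_zero_of_nonpos (sub_nonpos.2 h), zero_smul]

theorem GPvec_eq_zero {φx : ℝ} {a : V} (h : ‖a‖ ≤ φx) (k : V) : GPvec φx a k = 0 := by
  have h' : ‖a‖ - φx ∉ Set.Ioo (0 : ℝ) 1 := fun H => H.1.not_ge (sub_nonpos.2 h)
  rw [GPvec_eq, ramp_eq_zero_of_nonpos (sub_nonpos.2 h), Set.indicator_of_notMem h', zero_smul,
    zero_smul, add_zero]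

theorem abs_indicator_one_le_one (s : Set ℝ) (t : ℝ) : |s.indicator (fun _ => (1 : ℝ)) t| ≤ 1 := by
  by_cases h : t ∈ s <;> simp [h]

theorem norm_GPvec_le {ν φx : ℝ} (hν : 0 < ν) (hφ : ν ≤ φx) (a h : V) :
    ‖GPvec φx a h‖ ≤ (1 + 2 / ν) * ‖h‖ := by
  rcases le_or_gt ‖a‖ φx with ha | ha
  · rw [GPvec_eq_zero ha, norm_zero]
    positivity
  have hνa : ν ≤ ‖a‖ := hφ.trans ha.le
  have hα : 0 < ‖a‖ := hν.trans_le hνa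
  have hproj : ‖(⟪a, h⟫ / ‖a‖ ^ 2) • a‖ ≤ ‖h‖ := by
    rw [norm_smul, norm_div, norm_pow, norm_norm, div_mul_eq_mul_div, div_le_iff₀ (by positivity)]
    calc ‖⟪a, h⟫‖ * ‖a‖ ≤ ‖a‖ * ‖h‖ * ‖a‖ := by
          gcongr
          exact abs_real_inner_le_norm a h
      _ = ‖h‖ * ‖a‖ ^ 2 := by ring
  rw [GPvec_eq]
  refine (norm_add_le _ _).trans ?_
  rw [norm_smul, norm_smul _ (‖a‖⁻¹ • _), norm_smul ‖a‖⁻¹, norm_inv, norm_norm]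
  calc _ ≤ 1 * ‖h‖ + 1 * (ν⁻¹ * (‖h‖ + ‖h‖)) := by
        gcongr
        · exact abs_indicator_one_le_one _ _
        · exact abs_ramp_le_one _
        · exact (norm_sub_le _ _).trans (by gcongr)
    _ = (1 + 2 / ν) * ‖h‖ := by ring

theorem norm_Pvec_sub_le {ν φx : ℝ} (hν : 0 < ν) (hφ : ν ≤ φx) (a b : V) :
    ‖Pvec φx b - Pvec φx a‖ ≤ (1 + 2 / ν) * ‖b - a‖ := by
  have hd : |(‖b‖ - φx) - (‖a‖ - φx)| ≤ ‖b - a‖ := by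
    rw [sub_sub_sub_cancel_right]
    exact abs_norm_sub_norm_le b a
  have key : Pvec φx b - Pvec φx a =
      (min 1 (max 0 (‖b‖ - φx))) • (‖b‖⁻¹ • b - ‖a‖⁻¹ • a) +
      (min 1 (max 0 (‖b‖ - φx)) - min 1 (max 0 (‖a‖ - φx))) • (‖a‖⁻¹ • a) := by
    rw [Pvec_eq, Pvec_eq]
    module
  have h2 : ‖(min 1 (max 0 (‖b‖ - φx)) - min 1 (max 0 (‖a‖ - φx))) • (‖a‖⁻¹ • a)‖ ≤
      ‖b - a‖ * 1 := by
    rw [norm_smul]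
    gcongr
    · exact (abs_ramp_sub_ramp_le _ _).trans hd
    · exact norm_norm_inv_smul_le_one a
  have h1 : ‖(min 1 (max 0 (‖b‖ - φx))) • (‖b‖⁻¹ • b - ‖a‖⁻¹ • a)‖ ≤ 2 * ‖b - a‖ / ν := by
    rcases le_or_gt ‖b‖ φx with hb | hb
    · rw [ramp_eq_zero_of_nonpos (sub_nonpos.2 hb), zero_smul, norm_zero]
      positivity
    · have hνb : ν ≤ ‖b‖ := hφ.trans hb.le
      have hb0 : b ≠ 0 := norm_pos_iff.1 (hν.trans_le hνb)
      rw [norm_smul]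
      calc _ ≤ 1 * (2 * ‖b - a‖ / ‖b‖) := by
            gcongr
            · exact abs_ramp_le_one _
            · exact norm_norm_inv_smul_sub_le a hb0
        _ ≤ 2 * ‖b - a‖ / ν := by rw [one_mul]; gcongr
  rw [key]
  refine (norm_add_le _ _).trans ((add_le_add h1 h2).trans_eq ?_)
  ring

theorem norm_Pvec_remainder_le {ν φx : ℝ} (hν : 0 < ν) (hφ : ν ≤ φx) (a h : V) :
    ‖Pvec φx (a + h) - Pvec φx a - GPvec φx (a + h) h‖ ≤ 2 * (1 + 2 / ν) * ‖h‖ := by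
  have h1 := norm_Pvec_sub_le hν hφ a (a + h)
  rw [add_sub_cancel_left] at h1
  refine (norm_sub_le _ _).trans ((add_le_add h1 (norm_GPvec_le hν hφ (a + h) h)).trans_eq ?_)
  ring

theorem eventually_norm_Pvec_remainder_le {ν φx : ℝ} (hν : 0 < ν) (hφ : ν ≤ φx) (a : V) :
    ∀ᶠ h in nhds (0 : V), ‖Pvec φx (a + h) - Pvec φx a - GPvec φx (a + h) h‖ ≤
      3 * (1 / ν ^ 2 + 1 / ν) * ‖h‖ ^ 2 := by
  have hcont : Filter.Tendsto (fun h : V => ‖a + h‖ - φx) (nhds 0) (nhds (‖a‖ - φx)) := by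
    have : Continuous fun h : V => ‖a + h‖ - φx := by fun_prop
    simpa using this.tendsto 0
  filter_upwards [hcont.eventually (eventually_ramp_remainder_eq_zero (‖a‖ - φx))] with h he
  rw [sub_sub_sub_cancel_right] at he
  rcases le_or_gt ‖a + h‖ φx with hb | hb
  · have hb' : ‖a + h‖ - φx ≤ 0 := sub_nonpos.2 hb
    have hI : ‖a + h‖ - φx ∉ Set.Ioo (0 : ℝ) 1 := fun H => H.1.not_ge hb'
    rw [ramp_eq_zero_of_nonpos hb', Set.indicator_of_notMem hI, zero_mul, sub_zero, zero_sub,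
      neg_eq_zero] at he
    rw [Pvec_eq_zero hb, GPvec_eq_zero hb, Pvec_eq, he]
    simp only [zero_smul, sub_zero, norm_zero]
    positivity
  · have := norm_radial_remainder_le (a := a) hν (hφ.trans hb.le) (abs_ramp_le_one _)
      (abs_indicator_one_le_one _ _) he
    rw [add_sub_cancel_left] at this
    rwa [Pvec_eq, Pvec_eq, GPvec_eq]

theorem tendsto_norm_Pvec_remainder_div {ν φx : ℝ} (hν : 0 < ν) (hφ : ν ≤ φx) (a : V) :
    Filter.Tendsto
      (fun h : V => ‖Pvec φx (a + h) - Pvec φx a - GPvec φx (a + h) h‖ / ‖h‖)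
      (nhds 0) (nhds 0) := by
  have hlim : Filter.Tendsto (fun h : V => 3 * (1 / ν ^ 2 + 1 / ν) * ‖h‖) (nhds 0) (nhds 0) := by
    have : Continuous fun h : V => 3 * (1 / ν ^ 2 + 1 / ν) * ‖h‖ := by fun_prop
    simpa using this.tendsto 0
  refine squeeze_zero' (Filter.Eventually.of_forall fun h => by positivity) ?_ hlim
  filter_upwards [eventually_norm_Pvec_remainder_le hν hφ a] with h hh
  refine div_le_of_le_mul₀ (norm_nonneg _) (by positivity) (hh.trans_eq ?_)
  ring

theorem measurable_Pvec : Measurable fun z : ℝ × V => Pvec z.1 z.2 := by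
  simp only [Pvec_eq]
  fun_prop

theorem measurable_GPvec : Measurable fun z : ℝ × V × V => GPvec z.1 z.2.1 z.2.2 := by
  have hχ : Measurable fun z : ℝ × V × V =>
      (Set.Ioo (0 : ℝ) 1).indicator (fun _ => (1 : ℝ)) (‖z.2.1‖ - z.1) :=
    (measurable_const.indicator measurableSet_Ioo).comp (by fun_prop)
  simp only [GPvec_eq]
  fun_prop

end Field

section Superposition

variable {α : Type*} [MeasurableSpace α] {μ : Measure α} [IsFiniteMeasure μ]
  {E F : Type*} [NormedAddCommGroup E] [NormedAddCommGroup F]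

theorem exists_eLpNorm_le_mul_eLpNorm {p q : ℝ≥0∞} (hq : q ≠ 0) (hqp : q ≤ p) (hp : p ≠ ⊤) :
    ∃ c : NNReal, ∀ f : α → E, AEStronglyMeasurable f μ →
      eLpNorm f q μ ≤ c * eLpNorm f p μ := by
  have hexp : 0 ≤ 1 / q.toReal - 1 / p.toReal :=
    sub_nonneg.2 (one_div_le_one_div_of_le
      (ENNReal.toReal_pos hq (ne_top_of_le_ne_top hp hqp)) (ENNReal.toReal_mono hp hqp))
  have hc : μ Set.univ ^ (1 / q.toReal - 1 / p.toReal) ≠ ⊤ :=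
    ENNReal.rpow_ne_top_of_nonneg hexp (measure_ne_top μ _)
  refine ⟨(μ Set.univ ^ (1 / q.toReal - 1 / p.toReal)).toNNReal, fun f hf => ?_⟩
  rw [ENNReal.coe_toNNReal hc, mul_comm]
  exact eLpNorm_le_eLpNorm_mul_rpow_measure_univ hqp hf

theorem tendsto_eLpNorm_zero_of_bounded {r : ℝ≥0∞} (hr0 : r ≠ 0) (hr : r ≠ ⊤)
    {f : ℕ → α → F} (hf : ∀ n, AEStronglyMeasurable (f n) μ) {C : ℝ}
    (hC : ∀ n, ∀ᵐ x ∂μ, ‖f n x‖ ≤ C)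
    (hlim : ∀ᵐ x ∂μ, Filter.Tendsto (fun n => f n x) Filter.atTop (nhds 0)) :
    Filter.Tendsto (fun n => eLpNorm (f n) r μ) Filter.atTop (nhds 0) := by
  have hr' : 0 < r.toReal := ENNReal.toReal_pos hr0 hr
  have hint : Filter.Tendsto (fun n => ∫⁻ x, ‖f n x‖ₑ ^ r.toReal ∂μ) Filter.atTop
      (nhds (∫⁻ _, 0 ∂μ)) := by
    refine tendsto_lintegral_of_dominated_convergence' (fun _ => ENNReal.ofReal C ^ r.toReal)
      (fun n => (hf n).enorm.pow_const _) (fun n => ?_) ?_ ?_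
    · filter_upwards [hC n] with x hx
      gcongr
      rw [← ofReal_norm]
      exact ENNReal.ofReal_le_ofReal hx
    · rw [lintegral_const]
      exact ENNReal.mul_ne_top (ENNReal.rpow_ne_top_of_nonneg hr'.le ENNReal.ofReal_ne_top)
        (measure_ne_top μ _)
    · filter_upwards [hlim] with x hx
      simpa [hr', Function.comp_def] using ((ENNReal.continuous_rpow_const (y := r.toReal)).tendsto _).comp hx.enorm
  simp only [eLpNorm_eq_lintegral_rpow_enorm_toReal hr0 hr]
  rw [lintegral_zero] at hint
  simpa [hr', Function.comp_def] using
    ((ENNReal.continuous_rpow_const (y := 1 / r.toReal)).tendsto _).comp hint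

/-- A superposition operator whose generating function is `O(‖h‖)` uniformly and `o(‖h‖)` pointwise
is `o(‖h‖)` from `L^p` to `L^q`, when `2 * q ≤ p < ∞`. -/
theorem exists_norm_superposition_le_mul {p q : ℝ≥0∞} [Fact (1 ≤ p)] [Fact (1 ≤ q)]
    (hqp : 2 * q ≤ p) (hp : p ≠ ⊤) {r : α → E → F} {C : ℝ}
    (hC : ∀ᵐ x ∂μ, ∀ h, ‖r x h‖ ≤ C * ‖h‖)
    (hlim : ∀ᵐ x ∂μ, Filter.Tendsto (fun h => ‖r x h‖ / ‖h‖) (nhds 0) (nhds 0))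
    {ε : ℝ} (hε : 0 < ε) :
    ∃ δ > 0, ∀ w : Lp E p μ, ‖w‖ < δ → ∀ R : Lp F q μ, (⇑R =ᵐ[μ] fun x => r x (w x)) →
      ‖R‖ ≤ ε * ‖w‖ := by
  have hq1 : (1 : ℝ≥0∞) ≤ q := Fact.out
  have hq0 : q ≠ 0 := (zero_lt_one.trans_le hq1).ne'
  have h2q0 : 2 * q ≠ 0 := mul_ne_zero two_ne_zero hq0
  have h2q : 2 * q ≠ ⊤ := ne_top_of_le_ne_top hp hqp
  have : ENNReal.HolderTriple (2 * q) (2 * q) q := ⟨by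
    rw [ENNReal.mul_inv (by simp) (by simp), ← add_mul, ENNReal.inv_two_add_inv_two, one_mul]⟩
  obtain ⟨c, hc⟩ := exists_eLpNorm_le_mul_eLpNorm (E := E) (μ := μ) h2q0 hqp hp
  by_contra! H
  choose w hw R hR hlt using fun n : ℕ => H (1 / ((n : ℝ) + 1)) (by positivity)
  have hw0 : Filter.Tendsto w Filter.atTop (nhds 0) :=
    squeeze_zero_norm (fun n => (hw n).le) tendsto_one_div_add_atTop_nhds_zero_nat
  obtain ⟨ns, -, hns⟩ := (tendstoInMeasure_of_tendsto_Lp hw0).exists_seq_tendsto_ae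
  let ρ : ℕ → α → ℝ := fun n x => ‖R n x‖ / ‖w n x‖
  have hρm : ∀ n, AEStronglyMeasurable (ρ n) μ := fun n =>
    ((Lp.aestronglyMeasurable (R n)).norm.aemeasurable.div
      (Lp.aestronglyMeasurable (w n)).norm.aemeasurable).aestronglyMeasurable
  have hρC : ∀ n, ∀ᵐ x ∂μ, ‖ρ n x‖ ≤ max C 0 := by
    intro n
    filter_upwards [hC, hR n] with x hx hRx
    rw [Real.norm_of_nonneg (by positivity)]
    refine div_le_of_le_mul₀ (norm_nonneg _) (le_max_right _ _) ?_
    rw [hRx]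
    exact (hx _).trans (by gcongr; exact le_max_left _ _)
  have hρlim : Filter.Tendsto (fun k => eLpNorm (ρ (ns k)) (2 * q) μ) Filter.atTop (nhds 0) := by
    refine tendsto_eLpNorm_zero_of_bounded h2q0 h2q (fun k => hρm _) (fun k => hρC _) ?_
    filter_upwards [hns, hlim, ae_all_iff.2 hR, Lp.coeFn_zero E p μ] with x hx hlx hRx h0
    rw [h0] at hx
    simpa [ρ, hRx, Function.comp_def] using hlx.comp hx
  have hRle : ∀ n, ‖R n‖ ≤ (eLpNorm (ρ n) (2 * q) μ).toReal * c * ‖w n‖ := by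
    intro n
    have hfin : eLpNorm (ρ n) (2 * q) μ ≠ ⊤ := (MemLp.of_bound (hρm n) _ (hρC n)).eLpNorm_ne_top
    have hRρ : eLpNorm (R n) q μ ≤ eLpNorm (ρ n • fun x => ‖w n x‖) q μ := by
      refine eLpNorm_mono_ae_real ?_
      filter_upwards [hC, hR n] with x hx hRx
      rcases eq_or_ne (w n x) 0 with h0 | h0
      · have := hx (w n x)
        rw [← hRx, h0] at this
        simpa [h0] using this
      · simp [ρ, h0]
    have key : eLpNorm (R n) q μ ≤ eLpNorm (ρ n) (2 * q) μ * (c * eLpNorm (w n) p μ) :=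
      calc eLpNorm (R n) q μ ≤ eLpNorm (ρ n • fun x => ‖w n x‖) q μ := hRρ
        _ ≤ eLpNorm (ρ n) (2 * q) μ * eLpNorm (fun x => ‖w n x‖) (2 * q) μ :=
          eLpNorm_smul_le_mul_eLpNorm (Lp.aestronglyMeasurable (w n)).norm (hρm n)
        _ = eLpNorm (ρ n) (2 * q) μ * eLpNorm (w n) (2 * q) μ := by rw [eLpNorm_norm]
        _ ≤ _ := by
          gcongr
          exact hc _ (Lp.aestronglyMeasurable (w n))
    have := ENNReal.toReal_mono (ENNReal.mul_ne_top hfin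
      (ENNReal.mul_ne_top ENNReal.coe_ne_top (Lp.eLpNorm_ne_top (w n)))) key
    rwa [ENNReal.toReal_mul, ENNReal.toReal_mul, ENNReal.coe_toReal, ← Lp.norm_def, ← Lp.norm_def,
      ← mul_assoc] at this
  have hsmall : Filter.Tendsto (fun k => (eLpNorm (ρ (ns k)) (2 * q) μ).toReal * c) Filter.atTop
      (nhds 0) := by
    simpa using ((ENNReal.tendsto_toReal ENNReal.zero_ne_top).comp hρlim).mul_const (c : ℝ)
  obtain ⟨k, hk⟩ := (hsmall.eventually_lt_const hε).exists
  exact (hlt (ns k)).not_ge ((hRle (ns k)).trans (by gcongr))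

end Superposition

section Operators

variable {α : Type*} [MeasurableSpace α] {μ : Measure α} {d : ℕ} {φ : α → ℝ}

local notation "V" => EuclideanSpace ℝ (Fin d)

theorem aestronglyMeasurable_Pvec (hφ : Measurable φ) {v : α → V}
    (hv : AEStronglyMeasurable v μ) : AEStronglyMeasurable (fun x => Pvec (φ x) (v x)) μ :=
  (measurable_Pvec.comp_aemeasurable
    (hφ.aemeasurable.prodMk hv.aemeasurable)).aestronglyMeasurable

theorem aestronglyMeasurable_GPvec (hφ : Measurable φ) {v h : α → V}
    (hv : AEStronglyMeasurable v μ) (hh : AEStronglyMeasurable h μ) :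
    AEStronglyMeasurable (fun x => GPvec (φ x) (v x) (h x)) μ :=
  (measurable_GPvec.comp_aemeasurable
    (hφ.aemeasurable.prodMk (hv.aemeasurable.prodMk hh.aemeasurable))).aestronglyMeasurable

theorem memLp_Pvec [IsFiniteMeasure μ] (hφ : Measurable φ) {v : α → V}
    (hv : AEStronglyMeasurable v μ) (q : ℝ≥0∞) : MemLp (fun x => Pvec (φ x) (v x)) q μ :=
  MemLp.of_bound (aestronglyMeasurable_Pvec hφ hv) 1
    (Filter.Eventually.of_forall fun _ => norm_Pvec_le_one _ _)

theorem exists_GPvec_operator [IsFiniteMeasure μ] (hφ : Measurable φ) {ν : ℝ} (hν : 0 < ν)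
    (hφν : ∀ᵐ x ∂μ, ν ≤ φ x) {p q : ℝ≥0∞} [Fact (1 ≤ p)] [Fact (1 ≤ q)] (hqp : q ≤ p)
    (hp : p ≠ ⊤) {v : α → V} (hv : AEStronglyMeasurable v μ) :
    ∃ G : Lp V p μ →L[ℝ] Lp V q μ, ∀ h, ⇑(G h) =ᵐ[μ] fun x => GPvec (φ x) (v x) (h x) := by
  have hq0 : q ≠ 0 := (zero_lt_one.trans_le (Fact.out : (1 : ℝ≥0∞) ≤ q)).ne'
  obtain ⟨c, hc⟩ := exists_eLpNorm_le_mul_eLpNorm (E := V) (μ := μ) hq0 hqp hp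
  have hbound : ∀ h : Lp V p μ,
      ∀ᵐ x ∂μ, ‖GPvec (φ x) (v x) (h x)‖ ≤ (1 + 2 / ν) * ‖h x‖ := fun h =>
    hφν.mono fun x hx => norm_GPvec_le hν hx _ _
  have hmem : ∀ h : Lp V p μ, MemLp (fun x => GPvec (φ x) (v x) (h x)) q μ := fun h =>
    ((Lp.memLp h).mono_exponent hqp).of_le_mul
      (aestronglyMeasurable_GPvec hφ hv (Lp.aestronglyMeasurable h)) (hbound h)
  let L : Lp V p μ →ₗ[ℝ] Lp V q μ :=
    { toFun := fun h => (hmem h).toLp _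
      map_add' := fun h k => by
        refine Lp.ext ?_
        filter_upwards [(hmem (h + k)).coeFn_toLp, (hmem h).coeFn_toLp, (hmem k).coeFn_toLp,
          Lp.coeFn_add ((hmem h).toLp _) ((hmem k).toLp _), Lp.coeFn_add h k] with x h1 h2 h3 h4 h5
        rw [h1, h4, Pi.add_apply, h2, h3, h5, Pi.add_apply, GPvec_add]
      map_smul' := fun a h => by
        refine Lp.ext ?_
        filter_upwards [(hmem (a • h)).coeFn_toLp, (hmem h).coeFn_toLp,
          Lp.coeFn_smul a ((hmem h).toLp _), Lp.coeFn_smul a h] with x h1 h2 h3 h4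
        rw [h1, RingHom.id_apply, h3, Pi.smul_apply, h2, h4, Pi.smul_apply, GPvec_smul] }
  refine ⟨L.mkContinuous ((1 + 2 / ν) * c) fun h => ?_, fun h => (hmem h).coeFn_toLp⟩
  have key : eLpNorm (fun x => GPvec (φ x) (v x) (h x)) q μ ≤
      ENNReal.ofReal (1 + 2 / ν) * (c * eLpNorm h p μ) :=
    (eLpNorm_le_mul_eLpNorm_of_ae_le_mul (hbound h) q).trans
      (by gcongr; exact hc _ (Lp.aestronglyMeasurable h))
  have := ENNReal.toReal_mono (ENNReal.mul_ne_top ENNReal.ofReal_ne_top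
    (ENNReal.mul_ne_top ENNReal.coe_ne_top (Lp.eLpNorm_ne_top h))) key
  rwa [ENNReal.toReal_mul, ENNReal.toReal_mul, ENNReal.coe_toReal,
    ENNReal.toReal_ofReal (by positivity), ← Lp.norm_def, ← mul_assoc, ← Lp.norm_toLp _ (hmem h)]
    at this

end Operators

/-- for `Ω ⊂ ℝ^d` of finite measure, `φ ≥ ν > 0` a.e.,
`2 ≤ 2q ≤ p < ∞`, a real Banach space `X` and a bounded linear operator
`D : X → L^p(Ω; ℝ^d)`, the map `u ↦ P(D u)` (with `P` and `G_P` the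
superposition operators determined pointwise by `Pvec` and `GPvec`) is Newton
differentiable from `X` to `L^q(Ω; ℝ^d)` with Newton derivative
`u ↦ (h ↦ G_P(D u)(D h))`. -/
theorem P_comp_D_newton_diff
    (d : ℕ) (Ω : Set (EuclideanSpace ℝ (Fin d))) (hΩ : MeasurableSet Ω)
    (hΩfin : volume Ω < ⊤)
    (ν : ℝ) (hν : 0 < ν)
    (φ : EuclideanSpace ℝ (Fin d) → ℝ) (hφm : Measurable φ)
    (hφν : ∀ᵐ x ∂(volume.restrict Ω), ν ≤ φ x)
    (p q : ℝ≥0∞) [Fact (1 ≤ p)] [Fact (1 ≤ q)]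
    (h2q : 2 ≤ 2 * q) (hqp : 2 * q ≤ p) (hp : p ≠ ⊤)
    {X : Type*} [NormedAddCommGroup X] [NormedSpace ℝ X] [CompleteSpace X]
    (D : X →L[ℝ] Lp (EuclideanSpace ℝ (Fin d)) p (volume.restrict Ω)) :
    ∃ (P : Lp (EuclideanSpace ℝ (Fin d)) p (volume.restrict Ω) →
          Lp (EuclideanSpace ℝ (Fin d)) q (volume.restrict Ω))
      (G : Lp (EuclideanSpace ℝ (Fin d)) p (volume.restrict Ω) →
          (Lp (EuclideanSpace ℝ (Fin d)) p (volume.restrict Ω) →L[ℝ]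
            Lp (EuclideanSpace ℝ (Fin d)) q (volume.restrict Ω))),
      (∀ v, ⇑(P v) =ᵐ[volume.restrict Ω] fun x => Pvec (φ x) (v x)) ∧
      (∀ v h, ⇑(G v h) =ᵐ[volume.restrict Ω] fun x => GPvec (φ x) (v x) (h x)) ∧
      (∀ u : X, ∀ ε > 0, ∃ δ > 0, ∀ h : X, ‖h‖ < δ →
        ‖P (D (u + h)) - P (D u) - G (D (u + h)) (D h)‖ ≤ ε * ‖h‖) := by
  have : IsFiniteMeasure (volume.restrict Ω) := ⟨by simpa using hΩfin⟩
  have hqp' : q ≤ p := (le_mul_of_one_le_left' one_le_two).trans hqp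
  choose G hG using fun v : Lp (EuclideanSpace ℝ (Fin d)) p (volume.restrict Ω) =>
    exists_GPvec_operator (p := p) (q := q) hφm hν hφν hqp' hp (Lp.aestronglyMeasurable v)
  have hP : ∀ v : Lp (EuclideanSpace ℝ (Fin d)) p (volume.restrict Ω),
      MemLp (fun x => Pvec (φ x) (v x)) q (volume.restrict Ω) := fun v =>
    memLp_Pvec hφm (Lp.aestronglyMeasurable v) q
  refine ⟨fun v => (hP v).toLp _, G, fun v => (hP v).coeFn_toLp, hG, fun u ε hε => ?_⟩
  have hD : 0 < ‖D‖ + 1 := by positivity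
  obtain ⟨δ, hδ, H⟩ := exists_norm_superposition_le_mul (μ := volume.restrict Ω) (q := q) hqp hp
    (r := fun x h => Pvec (φ x) (D u x + h) - Pvec (φ x) (D u x) - GPvec (φ x) (D u x + h) h)
    (hφν.mono fun x hx h => norm_Pvec_remainder_le hν hx (D u x) h)
    (hφν.mono fun x hx => tendsto_norm_Pvec_remainder_div hν hx (D u x))
    (div_pos hε hD)
  refine ⟨δ / (‖D‖ + 1), div_pos hδ hD, fun h hh => ?_⟩
  have hDh : ‖D h‖ ≤ (‖D‖ + 1) * ‖h‖ :=
    (D.le_opNorm h).trans (by gcongr; exact le_add_of_nonneg_right zero_le_one)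
  have hlt : ‖D h‖ < δ := hDh.trans_lt (by rwa [lt_div_iff₀' hD] at hh)
  refine (H (D h) hlt _ ?_).trans ?_
  · filter_upwards [Lp.coeFn_sub ((hP (D (u + h))).toLp _ - (hP (D u)).toLp _)
        (G (D (u + h)) (D h)),
      Lp.coeFn_sub ((hP (D (u + h))).toLp _) ((hP (D u)).toLp _), (hP (D (u + h))).coeFn_toLp,
      (hP (D u)).coeFn_toLp, hG (D (u + h)) (D h), Lp.coeFn_add (D u) (D h)]
      with x h1 h2 h3 h4 h5 h6
    rw [← map_add, Pi.add_apply] at h6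
    rw [h1, Pi.sub_apply, h2, Pi.sub_apply, h3, h4, h5, h6]
  · calc ε / (‖D‖ + 1) * ‖D h‖ ≤ ε / (‖D‖ + 1) * ((‖D‖ + 1) * ‖h‖) := by gcongr
      _ = ε * ‖h‖ := by field_simp
end

section
/- Let (Ω, μ) be a finite measure space and let 1 ≤ q < p < ∞. Define the clamp function t^± := min(1, max(0, t)) for t ∈ ℝ, acting pointwise on functions. Then the superposition operator u ↦ u^± from L^p(Ω) to L^q(Ω) is Newton differentiable, with Newton derivative u ↦ (h ↦ χ_{(0,1)}(u)·h), where χ_{(0,1)}(u)(x) = 1 if 0 < u(x) < 1 and 0 otherwise; that is, for every u ∈ L^p(Ω), ‖(u+h)^± − u^± − χ_{(0,1)}(u+h)·h‖_{L^q} / ‖h‖_{L^p} → 0 as ‖h‖_{L^p} → 0. -/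
open MeasureTheory
open scoped ENNReal

open Classical in
/-- The size a perturbation of `t` must reach before the clamp function and its generalized
derivative fail to be exact at `t`. -/
noncomputable def clampThreshold (t : ℝ) : ℝ :=
  if t = 0 ∨ t = 1 then 1 else min |t| |t - 1|

lemma clampThreshold_pos (t : ℝ) : 0 < clampThreshold t := by
  unfold clampThreshold
  split_ifs with ht
  · exact one_pos
  · push Not at ht
    exact lt_min (abs_pos.2 ht.1) (abs_pos.2 (sub_ne_zero.2 ht.2))

lemma measurable_clampThreshold : Measurable clampThreshold := by
  classical
  have hs : MeasurableSet {t : ℝ | t = 0 ∨ t = 1} :=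
    (measurableSet_singleton (0 : ℝ)).union (measurableSet_singleton 1)
  have hmin : Measurable fun t : ℝ => min |t| |t - 1| := by fun_prop
  unfold clampThreshold
  exact Measurable.ite hs measurable_const hmin

lemma clamp_residual_eq_zero {u h : ℝ} (huh : |h| < clampThreshold u) :
    min 1 (max 0 (u + h)) - min 1 (max 0 u)
      - Set.indicator (Set.Ioo (0 : ℝ) 1) (fun _ => (1 : ℝ)) (u + h) * h = 0 := by
  classical
  have hd : (u = 0 → |h| < 1) ∧ (u = 1 → |h| < 1) ∧
      (u ≠ 0 → u ≠ 1 → |h| < |u| ∧ |h| < |u - 1|) := by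
    unfold clampThreshold at huh
    split_ifs at huh with hu
    · exact ⟨fun _ => huh, fun _ => huh, fun h0 h1 => absurd hu (by tauto)⟩
    · exact ⟨fun h0 => absurd (Or.inl h0) hu, fun h1 => absurd (Or.inr h1) hu,
        fun _ _ => lt_min_iff.1 huh⟩
  obtain ⟨h0, h1, h2⟩ := hd
  have hneg : u < 0 → u + h < 0 := fun hu => by
    have hlt := (h2 (by linarith) (by linarith)).1
    rw [abs_of_neg hu] at hlt
    linarith [le_abs_self h]
  have hpos : 0 < u → 0 < u + h := fun hu => by
    rcases eq_or_ne u 1 with hu1 | hu1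
    · linarith [neg_abs_le h, h1 hu1]
    · have hlt := (h2 hu.ne' hu1).1
      rw [abs_of_pos hu] at hlt
      linarith [neg_abs_le h]
  have hlt_one : u < 1 → u + h < 1 := fun hu => by
    rcases eq_or_ne u 0 with hu0 | hu0
    · linarith [le_abs_self h, h0 hu0]
    · have hlt := (h2 hu0 hu.ne).2
      rw [abs_of_neg (sub_neg.2 hu)] at hlt
      linarith [le_abs_self h]
  have hgt_one : 1 < u → 1 < u + h := fun hu => by
    have hlt := (h2 (by linarith) (by linarith)).2
    rw [abs_of_pos (sub_pos.2 hu)] at hlt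
    linarith [neg_abs_le h]
  clear h0 h1 h2 huh
  simp only [Set.indicator_apply, Set.mem_Ioo]
  split_ifs with hv
  · rw [one_mul]
    grind
  · rw [zero_mul, sub_zero]
    grind

lemma abs_clamp_residual_le (u h : ℝ) :
    |min 1 (max 0 (u + h)) - min 1 (max 0 u)
      - Set.indicator (Set.Ioo (0 : ℝ) 1) (fun _ => (1 : ℝ)) (u + h) * h| ≤ |h| := by
  classical
  simp only [Set.indicator_apply, Set.mem_Ioo]
  split_ifs with hv
  · rw [one_mul]
    grind
  · rw [zero_mul, sub_zero]
    grind

lemma abs_indicator_one_mul_le (s : Set ℝ) (a b : ℝ) :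
    |s.indicator (fun _ => (1 : ℝ)) a * b| ≤ |b| := by
  classical
  by_cases ha : a ∈ s <;> simp [ha]

lemma eLpNorm_indicator_le_mul_measure_rpow {Ω : Type*} [MeasurableSpace Ω] {μ : Measure Ω}
    {p q : ℝ≥0∞} (hqp : q ≤ p) {f : Ω → ℝ} (hf : AEStronglyMeasurable f μ)
    {s : Set Ω} (hs : MeasurableSet s) :
    eLpNorm (s.indicator f) q μ ≤
      eLpNorm f p μ * μ s ^ (1 / q.toReal - 1 / p.toReal) := by
  rw [eLpNorm_indicator_eq_eLpNorm_restrict hs]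
  refine (eLpNorm_le_eLpNorm_mul_rpow_measure_univ hqp hf.restrict).trans ?_
  rw [Measure.restrict_apply_univ]
  gcongr
  exact Measure.restrict_le_self

section

variable {Ω : Type*} [MeasurableSpace Ω] {μ : Measure Ω} [IsFiniteMeasure μ] {p q : ℝ≥0∞}

/-- A positive function is rarely dominated by a function that is small in `L^p`. -/
lemma exists_measure_le_abs_le {d : Ω → ℝ} (hd : Measurable d) (hpos : ∀ x, 0 < d x)
    (hp0 : p ≠ 0) (hp : p ≠ ⊤) {ε : ℝ≥0∞} (hε : 0 < ε) :
    ∃ δ > (0 : ℝ), ∀ h : Lp ℝ p μ, ‖h‖ < δ → μ {x | d x ≤ |h x|} ≤ ε := by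
  have hε2 : 0 < ε / 2 := ENNReal.half_pos hε.ne'
  have hlim := tendsto_measure_iInter_atTop (μ := μ)
    (s := fun n : ℕ => {x | d x ≤ 1 / ((n : ℝ) + 1)})
    (fun n => (measurableSet_le hd measurable_const).nullMeasurableSet)
    (fun m n hmn x hx => le_trans (show d x ≤ _ from hx) (Nat.one_div_le_one_div hmn))
    ⟨0, measure_ne_top _ _⟩
  have hempty : (⋂ n : ℕ, {x | d x ≤ 1 / ((n : ℝ) + 1)}) = ∅ := by
    refine Set.eq_empty_of_forall_notMem fun x hx => ?_
    obtain ⟨n, hn⟩ := exists_nat_one_div_lt (hpos x)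
    exact absurd (Set.mem_iInter.1 hx n) (not_le.2 hn)
  rw [hempty, measure_empty] at hlim
  obtain ⟨n, hn⟩ := (hlim.eventually (gt_mem_nhds hε2)).exists
  have hη : 0 < 1 / ((n : ℝ) + 1) := Nat.one_div_pos_of_nat
  set η : ℝ := 1 / ((n : ℝ) + 1)
  have hpr : 0 < p.toReal := ENNReal.toReal_pos hp0 hp
  have htend : Filter.Tendsto
      (fun δ : ℝ => (ENNReal.ofReal η)⁻¹ ^ p.toReal * ENNReal.ofReal δ ^ p.toReal)
      (nhds 0) (nhds 0) := by
    have h1 : Filter.Tendsto (fun δ : ℝ => ENNReal.ofReal δ ^ p.toReal) (nhds 0) (nhds 0) := by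
      have hc : Continuous fun δ : ℝ => ENNReal.ofReal δ ^ p.toReal :=
        ENNReal.continuous_rpow_const.comp ENNReal.continuous_ofReal
      simpa [ENNReal.zero_rpow_of_pos hpr] using hc.tendsto 0
    have h2 := ENNReal.Tendsto.const_mul h1 (a := (ENNReal.ofReal η)⁻¹ ^ p.toReal)
      (Or.inr (ENNReal.rpow_ne_top_of_nonneg hpr.le
        (ENNReal.inv_ne_top.2 (ENNReal.ofReal_pos.2 hη).ne')))
    simpa using h2
  obtain ⟨δ, hδ, hball⟩ := Metric.eventually_nhds_iff.1 (htend.eventually (gt_mem_nhds hε2))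
  refine ⟨δ, hδ, fun h hh => ?_⟩
  have hcheb := meas_ge_le_mul_pow_eLpNorm_enorm μ hp0 hp (Lp.aestronglyMeasurable h)
    (ENNReal.ofReal_pos.2 hη).ne' (by simp)
  have hsub : {x | d x ≤ |h x|} ⊆
      {x | d x ≤ η} ∪ {x | ENNReal.ofReal η ≤ ‖h x‖ₑ} := by
    intro x hx
    rcases le_or_gt (d x) η with hdx | hdx
    · exact Or.inl hdx
    · refine Or.inr ?_
      change ENNReal.ofReal η ≤ ‖h x‖ₑ
      rw [Real.enorm_eq_ofReal_abs]
      exact ENNReal.ofReal_le_ofReal (hdx.le.trans hx)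
  have hsmall := hball (y := ‖h‖) (by
     rwa [Real.dist_0_eq_abs, abs_of_nonneg (show 0 ≤ ‖h‖ from ENNReal.toReal_nonneg)])
  rw [Lp.norm_def, ENNReal.ofReal_toReal (Lp.eLpNorm_ne_top h)] at hsmall
  calc μ {x | d x ≤ |h x|} ≤ _ := measure_mono hsub
    _ ≤ _ := measure_union_le _ _
    _ ≤ ε / 2 + ε / 2 := add_le_add hn.le (hcheb.trans hsmall.le)
    _ = ε := ENNReal.add_halves ε

lemma memLp_clamp (u : Lp ℝ p μ) : MemLp (fun x => min 1 (max 0 (u x))) q μ := by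
  have hu := (Lp.stronglyMeasurable u).measurable
  refine MemLp.of_bound (by fun_prop) 1 (Filter.Eventually.of_forall fun x => ?_)
  rw [Real.norm_eq_abs, abs_of_nonneg (le_min zero_le_one (le_max_left _ _))]
  exact min_le_left _ _

lemma memLp_indicator_one_mul (hqp : q ≤ p) (u h : Lp ℝ p μ) :
    MemLp (fun x => Set.indicator (Set.Ioo (0 : ℝ) 1) (fun _ => (1 : ℝ)) (u x) * h x) q μ := by
  have hu := (Lp.stronglyMeasurable u).measurable
  have hh := (Lp.stronglyMeasurable h).measurable
  have hχ : Measurable (Set.indicator (Set.Ioo (0 : ℝ) 1) fun _ => (1 : ℝ)) :=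
    measurable_const.indicator measurableSet_Ioo
  exact ((Lp.memLp h).mono_exponent hqp).of_le
    ((hχ.comp hu).mul hh).aestronglyMeasurable
    (Filter.Eventually.of_forall fun x => abs_indicator_one_mul_le _ _ _)

/-- Multiplication by `χ_{(0,1)}(u)` as a bounded operator from `L^p` to `L^q`. -/
noncomputable def clampDeriv [Fact (1 ≤ p)] [Fact (1 ≤ q)] (hqp : q ≤ p) (u : Lp ℝ p μ) :
    Lp ℝ p μ →L[ℝ] Lp ℝ q μ :=
  LinearMap.mkContinuous
    { toFun := fun h => (memLp_indicator_one_mul hqp u h).toLp _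
      map_add' := fun f g => by
        rw [← MemLp.toLp_add]
        refine MemLp.toLp_congr _ _ ?_
        filter_upwards [Lp.coeFn_add f g] with x hx
        simp only [hx, Pi.add_apply, mul_add]
      map_smul' := fun c f => by
        rw [RingHom.id_apply, ← MemLp.toLp_const_smul]
        refine MemLp.toLp_congr _ _ ?_
        filter_upwards [Lp.coeFn_smul c f] with x hx
        simp only [hx, Pi.smul_apply, smul_eq_mul]
        ring }
    (μ Set.univ ^ (1 / q.toReal - 1 / p.toReal)).toReal
    fun h => by
      have hq0 : 0 < q := one_pos.trans_le Fact.out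
      have hexp : 0 ≤ 1 / q.toReal - 1 / p.toReal := by
        rcases eq_or_ne p ⊤ with rfl | hp
        · simp
        · exact sub_nonneg.2 (one_div_le_one_div_of_le
            (ENNReal.toReal_pos hq0.ne' (ne_top_of_le_ne_top hp hqp)) (ENNReal.toReal_mono hp hqp))
      rw [LinearMap.coe_mk, AddHom.coe_mk, Lp.norm_toLp, Lp.norm_def, mul_comm,
        ← ENNReal.toReal_mul]
      refine ENNReal.toReal_mono (ENNReal.mul_ne_top (Lp.eLpNorm_ne_top h)
        (ENNReal.rpow_ne_top_of_nonneg hexp (measure_ne_top _ _))) ?_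
      exact (eLpNorm_mono_ae (Filter.Eventually.of_forall fun x =>
        abs_indicator_one_mul_le _ _ _)).trans
        (eLpNorm_le_eLpNorm_mul_rpow_measure_univ hqp (Lp.aestronglyMeasurable h))

lemma coeFn_clampDeriv [Fact (1 ≤ p)] [Fact (1 ≤ q)] (hqp : q ≤ p) (u h : Lp ℝ p μ) :
    ⇑(clampDeriv hqp u h) =ᵐ[μ]
      fun x => Set.indicator (Set.Ioo (0 : ℝ) 1) (fun _ => (1 : ℝ)) (u x) * h x :=
  (memLp_indicator_one_mul hqp u h).coeFn_toLp

end

/-- on a finite measure space, for `1 ≤ q < p < ∞`, the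
superposition operator `u ↦ u^± = min(1, max(0, u))` is well defined and Newton
differentiable from `L^p` to `L^q`, with Newton derivative
`u ↦ (h ↦ χ_{(0,1)}(u)·h)`. -/
theorem clamp_superposition_newton_diff
    {Ω : Type*} [MeasurableSpace Ω] (μ : Measure Ω) [IsFiniteMeasure μ]
    (p q : ℝ≥0∞) [Fact (1 ≤ p)] [Fact (1 ≤ q)] (hqp : q < p) (hp : p ≠ ⊤) :
    ∃ (C : Lp ℝ p μ → Lp ℝ q μ)
      (G : Lp ℝ p μ → (Lp ℝ p μ →L[ℝ] Lp ℝ q μ)),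
      (∀ u : Lp ℝ p μ, ⇑(C u) =ᵐ[μ] fun x => min 1 (max 0 (u x))) ∧
      (∀ u h : Lp ℝ p μ, ⇑(G u h) =ᵐ[μ]
        fun x => Set.indicator (Set.Ioo (0 : ℝ) 1) (fun _ => (1 : ℝ)) (u x) * h x) ∧
      (∀ u : Lp ℝ p μ, ∀ ε > 0, ∃ δ > 0, ∀ h : Lp ℝ p μ, ‖h‖ < δ →
        ‖C (u + h) - C u - G (u + h) h‖ ≤ ε * ‖h‖) := by
  have hq0 : 0 < q := one_pos.trans_le Fact.out
  have hp0 : 0 < p := one_pos.trans_le Fact.out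
  have hexp : 0 < 1 / q.toReal - 1 / p.toReal :=
    sub_pos.2 (one_div_lt_one_div_of_lt (ENNReal.toReal_pos hq0.ne' hqp.ne_top)
      (ENNReal.toReal_strict_mono hp hqp))
  refine ⟨fun u => (memLp_clamp u).toLp _, clampDeriv hqp.le, fun u => (memLp_clamp u).coeFn_toLp,
    coeFn_clampDeriv hqp.le, fun u ε hε => ?_⟩
  have hd : Measurable fun x => clampThreshold (u x) :=
    measurable_clampThreshold.comp (Lp.stronglyMeasurable u).measurable
  obtain ⟨δ, hδ, hsmall⟩ := exists_measure_le_abs_le (μ := μ) hd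
    (fun x => clampThreshold_pos _) hp0.ne' hp
    (ENNReal.rpow_pos (ENNReal.ofReal_pos.2 hε) ENNReal.ofReal_ne_top
      (p := (1 / q.toReal - 1 / p.toReal)⁻¹))
  refine ⟨δ, hδ, fun h hh => ?_⟩
  have hs : MeasurableSet {x | clampThreshold (u x) ≤ |h x|} :=
    measurableSet_le hd (Lp.stronglyMeasurable h).measurable.abs
  have hle : ∀ᵐ x ∂μ, ‖((memLp_clamp (q := q) (u + h)).toLp _ - (memLp_clamp (q := q) u).toLp _
      - clampDeriv hqp.le (u + h) h : Lp ℝ q μ) x‖ ≤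
      ‖{x | clampThreshold (u x) ≤ |h x|}.indicator h x‖ := by
    filter_upwards [Lp.coeFn_sub ((memLp_clamp (q := q) (u + h)).toLp _
        - (memLp_clamp (q := q) u).toLp _) (clampDeriv hqp.le (u + h) h),
      Lp.coeFn_sub ((memLp_clamp (q := q) (u + h)).toLp _) ((memLp_clamp (q := q) u).toLp _),
      (memLp_clamp (q := q) (u + h)).coeFn_toLp, (memLp_clamp (q := q) u).coeFn_toLp,
      coeFn_clampDeriv hqp.le (u + h) h, Lp.coeFn_add u h] with x h1 h2 h3 h4 h5 h6
    rw [h1, Pi.sub_apply, h2, Pi.sub_apply, h3, h4, h5, h6, Pi.add_apply]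
    by_cases hx : clampThreshold (u x) ≤ |h x|
    · rw [Set.indicator_of_mem (show x ∈ {x | clampThreshold (u x) ≤ |h x|} from hx)]
      exact abs_clamp_residual_le _ _
    · rw [clamp_residual_eq_zero (not_le.1 hx), norm_zero]
      exact norm_nonneg _
  have hbound := (eLpNorm_mono_ae hle).trans
    (eLpNorm_indicator_le_mul_measure_rpow hqp.le (Lp.aestronglyMeasurable h) hs)
  have hfactor : μ {x | clampThreshold (u x) ≤ |h x|} ^ (1 / q.toReal - 1 / p.toReal) ≤
      ENNReal.ofReal ε := by
    refine (ENNReal.rpow_le_rpow (hsmall h hh) hexp.le).trans_eq ?_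
    rw [ENNReal.rpow_inv_rpow hexp.ne']
  have htotal := ENNReal.toReal_mono
    (ENNReal.mul_ne_top (Lp.eLpNorm_ne_top h) ENNReal.ofReal_ne_top)
    (hbound.trans (mul_le_mul_right hfactor _))
  rw [ENNReal.toReal_mul, ENNReal.toReal_ofReal hε.le, mul_comm] at htotal
  exact htotal
end

section
/- Let Ω ⊂ ℝ^d be a measurable set of finite Lebesgue measure, ν > 0, φ : Ω → ℝ measurable with φ(x) ≥ ν for a.e. x ∈ Ω, and 2 ≤ 2q ≤ p < ∞. Define b : L^p(Ω; ℝ^d) → L^q(Ω) by (b(u))(x) = (|u(x)| − φ(x))^±, where t^± := min(1, max(0, t)). Then b is Newton differentiable, with Newton derivative G_b given by (G_b(u)h)(x) = χ_{(0,1)}(|u(x)| − φ(x)) · (u(x)·h(x))/|u(x)| for u(x) ≠ 0 and (G_b(u)h)(x) = 0 where u(x) = 0; that is, for every u ∈ L^p(Ω; ℝ^d), ‖b(u+h) − b(u) − G_b(u+h)h‖_{L^q} / ‖h‖_{L^p} → 0 as ‖h‖_{L^p} → 0. -/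
open MeasureTheory RealInnerProductSpace Classical
open scoped ENNReal

/-- The pointwise Newton derivative of `a ↦ (|a| − φx)^±`: for `a ≠ 0`,
`χ_{(0,1)}(|a| − φx) (a·h)/|a|`, and `0` for `a = 0`. -/
noncomputable def Gbval {d : ℕ} (φx : ℝ) (a h : EuclideanSpace ℝ (Fin d)) : ℝ :=
  if a = 0 then 0 else
    Set.indicator (Set.Ioo (0 : ℝ) 1) (fun _ => (1 : ℝ)) (‖a‖ - φx) * (⟪a, h⟫ / ‖a‖)

open Filter Topology

theorem abs_clamp_sub_clamp_le (s t : ℝ) :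
    |min 1 (max 0 s) - min 1 (max 0 t)| ≤ |s - t| :=
  (abs_min_sub_min_le_max 1 (max 0 s) 1 (max 0 t)).trans <| by
    rw [sub_self, abs_zero, max_eq_right (abs_nonneg _)]
    refine (abs_max_sub_max_le_max 0 s 0 t).trans ?_
    rw [sub_self, abs_zero, max_eq_right (abs_nonneg _)]

theorem eventually_clamp_sub_clamp_eq (t : ℝ) :
    ∀ᶠ s in 𝓝 t, min 1 (max 0 s) - min 1 (max 0 t) =
      Set.indicator (Set.Ioo (0 : ℝ) 1) (fun _ => (1 : ℝ)) s * (s - t) := by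
  have h₁ : ∀ᶠ s in 𝓝 t, t < 0 → s < 0 := by
    by_cases h : t < 0
    · filter_upwards [eventually_lt_nhds h] with s hs _ using hs
    · simp [h]
  have h₂ : ∀ᶠ s in 𝓝 t, 0 < t → 0 < s := by
    by_cases h : 0 < t
    · filter_upwards [eventually_gt_nhds h] with s hs _ using hs
    · simp [h]
  have h₃ : ∀ᶠ s in 𝓝 t, t < 1 → s < 1 := by
    by_cases h : t < 1
    · filter_upwards [eventually_lt_nhds h] with s hs _ using hs
    · simp [h]
  have h₄ : ∀ᶠ s in 𝓝 t, 1 < t → 1 < s := by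
    by_cases h : 1 < t
    · filter_upwards [eventually_gt_nhds h] with s hs _ using hs
    · simp [h]
  filter_upwards [h₁, h₂, h₃, h₄] with s h₁ h₂ h₃ h₄
  simp only [Set.indicator_apply, Set.mem_Ioo]
  grind

section Gbval

variable {d : ℕ}

theorem Gbval_eq (c : ℝ) (a h : EuclideanSpace ℝ (Fin d)) :
    Gbval c a h =
      Set.indicator (Set.Ioo (0 : ℝ) 1) (fun _ => (1 : ℝ)) (‖a‖ - c) * (⟪a, h⟫ / ‖a‖) := by
  unfold Gbval
  split_ifs with ha <;> simp [ha]

theorem Gbval_add (c : ℝ) (a h k : EuclideanSpace ℝ (Fin d)) :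
    Gbval c a (h + k) = Gbval c a h + Gbval c a k := by
  simp only [Gbval_eq, inner_add_right]
  ring

theorem Gbval_smul (c r : ℝ) (a h : EuclideanSpace ℝ (Fin d)) :
    Gbval c a (r • h) = r * Gbval c a h := by
  simp only [Gbval_eq, real_inner_smul_right]
  ring

theorem abs_Gbval_le (c : ℝ) (a h : EuclideanSpace ℝ (Fin d)) : |Gbval c a h| ≤ ‖h‖ := by
  have hi : |⟪a, h⟫ / ‖a‖| ≤ ‖h‖ := by
    rw [abs_div, abs_norm]
    exact div_le_of_le_mul₀ (norm_nonneg _) (norm_nonneg _)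
      ((abs_real_inner_le_norm a h).trans_eq (mul_comm _ _))
  rw [Gbval_eq, Set.indicator_apply]
  split_ifs
  · simpa using hi
  · simp

/-- The Newton remainder of `a ↦ min 1 (max 0 (‖a‖ - c))` at `a` with increment `h`. -/
noncomputable def newtonRemainder (c : ℝ) (a h : EuclideanSpace ℝ (Fin d)) : ℝ :=
  min 1 (max 0 (‖a + h‖ - c)) - min 1 (max 0 (‖a‖ - c)) - Gbval c (a + h) h

theorem abs_newtonRemainder_le (c : ℝ) (a h : EuclideanSpace ℝ (Fin d)) :
    |newtonRemainder c a h| ≤ 2 * ‖h‖ := by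
  have h₁ := abs_clamp_sub_clamp_le (‖a + h‖ - c) (‖a‖ - c)
  have h₂ : |‖a + h‖ - c - (‖a‖ - c)| ≤ ‖h‖ := by
    simpa using abs_norm_sub_norm_le (a + h) a
  have h₃ := abs_Gbval_le c (a + h) h
  have h₄ := abs_sub (min 1 (max 0 (‖a + h‖ - c)) - min 1 (max 0 (‖a‖ - c))) (Gbval c (a + h) h)
  unfold newtonRemainder
  linarith

theorem abs_norm_sub_norm_sub_inner_div_le {E : Type*} [NormedAddCommGroup E]
    [InnerProductSpace ℝ E] {c : ℝ} (hc : 0 < c) {a b : E} (hb : c ≤ ‖b‖) :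
    |‖b‖ - ‖a‖ - ⟪b, b - a⟫ / ‖b‖| ≤ ‖b - a‖ ^ 2 / (2 * c) := by
  have hb0 : 0 < ‖b‖ := hc.trans_le hb
  have h₁ : ‖b‖ - ‖a‖ - ⟪b, b - a⟫ / ‖b‖ = -((‖a‖ * ‖b‖ - ⟪b, a⟫) / ‖b‖) := by
    rw [inner_sub_right, real_inner_self_eq_norm_sq]
    field_simp
    ring
  have h₂ := real_inner_le_norm b a
  have h₃ := norm_sub_sq_real b a
  rw [h₁, abs_neg, abs_of_nonneg (div_nonneg (by linarith) hb0.le)]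
  rw [div_le_div_iff₀ hb0 (by positivity)]
  have h₄ : ‖a‖ * ‖b‖ - ⟪b, a⟫ ≤ ‖b - a‖ ^ 2 / 2 := by
    nlinarith [sq_nonneg (‖b‖ - ‖a‖)]
  calc (‖a‖ * ‖b‖ - ⟪b, a⟫) * (2 * c) ≤ ‖b - a‖ ^ 2 / 2 * (2 * c) := by gcongr
    _ = ‖b - a‖ ^ 2 * c := by ring
    _ ≤ ‖b - a‖ ^ 2 * ‖b‖ := by gcongr

theorem tendsto_newtonRemainder_div_norm {c : ℝ} (hc : 0 < c) (a : EuclideanSpace ℝ (Fin d)) :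
    Tendsto (fun h => newtonRemainder c a h / ‖h‖) (𝓝 0) (𝓝 0) := by
  have hcont : Tendsto (fun h : EuclideanSpace ℝ (Fin d) => ‖a + h‖ - c) (𝓝 0) (𝓝 (‖a‖ - c)) := by
    have : Continuous fun h : EuclideanSpace ℝ (Fin d) => ‖a + h‖ - c := by fun_prop
    simpa using this.tendsto 0
  have hbound : Tendsto (fun h : EuclideanSpace ℝ (Fin d) => ‖h‖ / (2 * c)) (𝓝 0) (𝓝 0) := by
    have : Continuous fun h : EuclideanSpace ℝ (Fin d) => ‖h‖ / (2 * c) := by fun_prop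
    simpa using this.tendsto 0
  refine squeeze_zero_norm' ?_ hbound
  filter_upwards [hcont.eventually (eventually_clamp_sub_clamp_eq (‖a‖ - c))] with h hh
  have key : |newtonRemainder c a h| ≤ ‖h‖ ^ 2 / (2 * c) := by
    rw [newtonRemainder, hh, Gbval_eq, ← mul_sub, Set.indicator_apply]
    split_ifs with hmem
    · have hb : c ≤ ‖a + h‖ := by linarith [hmem.1]
      simpa using abs_norm_sub_norm_sub_inner_div_le hc (a := a) hb
    · simp only [zero_mul, abs_zero]
      positivity
  rw [norm_div, norm_norm, Real.norm_eq_abs]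
  refine div_le_of_le_mul₀ (norm_nonneg _) (by positivity) (key.trans_eq ?_)
  ring

variable {α : Type*} [MeasurableSpace α] {μ : Measure α} {φ : α → ℝ}

theorem aestronglyMeasurable_clamp (hφ : Measurable φ) {u : α → EuclideanSpace ℝ (Fin d)}
    (hu : AEStronglyMeasurable u μ) :
    AEStronglyMeasurable (fun x => min 1 (max 0 (‖u x‖ - φ x))) μ := by
  have := hu.aemeasurable
  exact AEMeasurable.aestronglyMeasurable (by fun_prop)

theorem aestronglyMeasurable_Gbval (hφ : Measurable φ) {u h : α → EuclideanSpace ℝ (Fin d)}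
    (hu : AEStronglyMeasurable u μ) (hh : AEStronglyMeasurable h μ) :
    AEStronglyMeasurable (fun x => Gbval (φ x) (u x) (h x)) μ := by
  simp only [Gbval_eq]
  have hu' := hu.aemeasurable
  have hi : Measurable (Set.indicator (Set.Ioo (0 : ℝ) 1) (fun _ => (1 : ℝ))) :=
    measurable_const.indicator measurableSet_Ioo
  have hinner := (hu.inner (𝕜 := ℝ) hh).aemeasurable
  have h₁ : AEMeasurable (fun x => ‖u x‖ - φ x) μ := by fun_prop
  exact ((hi.comp_aemeasurable h₁).mul (hinner.div hu'.norm)).aestronglyMeasurable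

theorem aestronglyMeasurable_newtonRemainder (hφ : Measurable φ)
    {u h : α → EuclideanSpace ℝ (Fin d)}
    (hu : AEStronglyMeasurable u μ) (hh : AEStronglyMeasurable h μ) :
    AEStronglyMeasurable (fun x => newtonRemainder (φ x) (u x) (h x)) μ :=
  ((aestronglyMeasurable_clamp hφ (hu.add hh)).sub (aestronglyMeasurable_clamp hφ hu)).sub
    (aestronglyMeasurable_Gbval hφ (hu.add hh) hh)

theorem memLp_Gbval [IsFiniteMeasure μ] {p q : ℝ≥0∞} (hqp : q ≤ p) (hφ : Measurable φ)
    {u h : α → EuclideanSpace ℝ (Fin d)} (hu : AEStronglyMeasurable u μ) (hh : MemLp h p μ) :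
    MemLp (fun x => Gbval (φ x) (u x) (h x)) q μ :=
  (hh.mono (aestronglyMeasurable_Gbval hφ hu hh.1)
    (.of_forall fun _ => abs_Gbval_le _ _ _)).mono_exponent hqp

theorem memLp_clamp_s12 [IsFiniteMeasure μ] {q : ℝ≥0∞} (hφ : Measurable φ)
    {u : α → EuclideanSpace ℝ (Fin d)} (hu : AEStronglyMeasurable u μ) :
    MemLp (fun x => min 1 (max 0 (‖u x‖ - φ x))) q μ :=
  .of_bound (aestronglyMeasurable_clamp hφ hu) 1 <| .of_forall fun x => by
    rw [Real.norm_of_nonneg (by positivity)]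
    exact min_le_left _ _

/-- Pointwise application of `Gbval` as a continuous linear map `L^p → L^q`. -/
noncomputable def GbvalCLM [IsFiniteMeasure μ] {p q : ℝ≥0∞} [Fact (1 ≤ p)] [Fact (1 ≤ q)]
    (hp : p ≠ ⊤) (hqp : q ≤ p) (hφ : Measurable φ) (u : Lp (EuclideanSpace ℝ (Fin d)) p μ) :
    Lp (EuclideanSpace ℝ (Fin d)) p μ →L[ℝ] Lp ℝ q μ :=
  LinearMap.mkContinuous
    { toFun := fun h => (memLp_Gbval hqp hφ (Lp.aestronglyMeasurable u) (Lp.memLp h)).toLp _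
      map_add' := fun h k => by
        rw [← MemLp.toLp_add, MemLp.toLp_eq_toLp_iff]
        filter_upwards [Lp.coeFn_add h k] with x hx
        simp only [Pi.add_apply, hx, Gbval_add]
      map_smul' := fun r h => by
        rw [RingHom.id_apply, ← MemLp.toLp_const_smul, MemLp.toLp_eq_toLp_iff]
        filter_upwards [Lp.coeFn_smul r h] with x hx
        simp [hx, Gbval_smul] }
    (μ Set.univ ^ (1 / q.toReal - 1 / p.toReal)).toReal
    fun h => by
      have hle : eLpNorm (fun x => Gbval (φ x) (u x) (h x)) q μ ≤
          μ Set.univ ^ (1 / q.toReal - 1 / p.toReal) * eLpNorm h p μ := by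
        rw [mul_comm]
        refine (eLpNorm_mono (g := h) fun x => abs_Gbval_le _ _ _).trans ?_
        exact eLpNorm_le_eLpNorm_mul_rpow_measure_univ hqp (Lp.aestronglyMeasurable h)
      have hexp : 0 ≤ 1 / q.toReal - 1 / p.toReal :=
        sub_nonneg.2 <| one_div_le_one_div_of_le
          (ENNReal.toReal_pos (one_pos.trans_le (Fact.out : 1 ≤ q)).ne' (ne_top_of_le_ne_top hp hqp))
          (ENNReal.toReal_mono hp hqp)
      simp only [LinearMap.coe_mk, AddHom.coe_mk, Lp.norm_toLp]
      rw [Lp.norm_def, ← ENNReal.toReal_mul]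
      exact ENNReal.toReal_mono (ENNReal.mul_ne_top
        (ENNReal.rpow_ne_top_of_nonneg hexp (measure_ne_top _ _)) (Lp.eLpNorm_ne_top h)) hle

theorem coeFn_GbvalCLM [IsFiniteMeasure μ] {p q : ℝ≥0∞} [Fact (1 ≤ p)] [Fact (1 ≤ q)]
    (hp : p ≠ ⊤) (hqp : q ≤ p) (hφ : Measurable φ) (u h : Lp (EuclideanSpace ℝ (Fin d)) p μ) :
    GbvalCLM hp hqp hφ u h =ᵐ[μ] fun x => Gbval (φ x) (u x) (h x) :=
  MemLp.coeFn_toLp (memLp_Gbval hqp hφ (Lp.aestronglyMeasurable u) (Lp.memLp h))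

theorem eLpNorm_newtonRemainder_le {p q s : ℝ≥0∞} [ENNReal.HolderTriple s p q]
    (hφ : Measurable φ) {u h : α → EuclideanSpace ℝ (Fin d)}
    (hu : AEStronglyMeasurable u μ) (hh : AEStronglyMeasurable h μ) :
    eLpNorm (fun x => newtonRemainder (φ x) (u x) (h x)) q μ ≤
      eLpNorm (fun x => newtonRemainder (φ x) (u x) (h x) / ‖h x‖) s μ * eLpNorm h p μ := by
  have hR := aestronglyMeasurable_newtonRemainder hφ hu hh
  have hdiv := (hR.aemeasurable.div hh.norm.aemeasurable).aestronglyMeasurable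
  have := eLpNorm_smul_le_mul_eLpNorm (p := s) (q := p) (r := q) hh.norm hdiv
  rw [eLpNorm_norm] at this
  refine le_of_eq_of_le ?_ this
  congr 1
  ext x
  by_cases hx : h x = 0
  · have := abs_newtonRemainder_le (φ x) (u x) (h x)
    simp_all
  · simp [hx]

end Gbval

theorem tendsto_eLpNorm_zero_of_bounded_s12 {α E : Type*} [MeasurableSpace α] {μ : Measure α}
    [IsFiniteMeasure μ] [NormedAddCommGroup E] {s : ℝ≥0∞} (hs0 : s ≠ 0) (hs : s ≠ ⊤)
    {w : ℕ → α → E} (hw : ∀ n, AEStronglyMeasurable (w n) μ) (C : ℝ) (hC : ∀ n x, ‖w n x‖ ≤ C)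
    (hlim : ∀ᵐ x ∂μ, Tendsto (fun n => w n x) atTop (𝓝 0)) :
    Tendsto (fun n => eLpNorm (w n) s μ) atTop (𝓝 0) := by
  have hpos := ENNReal.toReal_pos hs0 hs
  have key : Tendsto (fun n => ∫⁻ x, ‖w n x‖ₑ ^ s.toReal ∂μ) atTop (𝓝 (∫⁻ _, 0 ∂μ)) := by
    refine tendsto_lintegral_of_dominated_convergence'
      (fun _ => ENNReal.ofReal C ^ s.toReal) (fun n => (hw n).enorm.pow_const _)
      (fun n => .of_forall fun x => ?_) ?_ ?_
    · refine ENNReal.rpow_le_rpow ?_ hpos.le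
      rw [← ofReal_norm]
      exact ENNReal.ofReal_le_ofReal (hC n x)
    · rw [lintegral_const]
      exact ENNReal.mul_ne_top (ENNReal.rpow_ne_top_of_nonneg hpos.le ENNReal.ofReal_ne_top)
        (measure_ne_top _ _)
    · filter_upwards [hlim] with x hx
      have := (ENNReal.continuous_rpow_const (y := s.toReal)).tendsto 0 |>.comp
        ((continuous_enorm.tendsto (0 : E)).comp hx |>.trans (by simp))
      simpa [hpos, Function.comp_def] using this
  have h := (ENNReal.continuous_rpow_const (y := 1 / s.toReal)).tendsto _ |>.comp key
  simp only [eLpNorm_eq_lintegral_rpow_enorm_toReal hs0 hs]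
  simpa [hpos, Function.comp_def] using h

theorem exists_holderTriple_of_lt {p q : ℝ≥0∞} (hq : q ≠ 0) (hqp : q < p) :
    ∃ s : ℝ≥0∞, s ≠ 0 ∧ s ≠ ⊤ ∧ ENNReal.HolderTriple s p q := by
  have hlt : p⁻¹ < q⁻¹ := ENNReal.inv_lt_inv.2 hqp
  refine ⟨(q⁻¹ - p⁻¹)⁻¹, ?_, ?_, ⟨?_⟩⟩
  · simp [ENNReal.sub_eq_top_iff, hq]
  · simpa [tsub_eq_zero_iff_le] using hqp
  · rw [inv_inv, tsub_add_cancel_of_le hlt.le]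

/-- for `Ω ⊂ ℝ^d` of finite measure, `φ ≥ ν > 0` a.e. and
`2 ≤ 2q ≤ p < ∞`, the superposition operator `b(u)(x) = (|u(x)| − φ(x))^±`
(with `t^± = min(1, max(0, t))`) is Newton differentiable from `L^p(Ω; ℝ^d)` to
`L^q(Ω)`, with Newton derivative `G_b` given pointwise by
`(G_b(u)h)(x) = χ_{(0,1)}(|u(x)| − φ(x)) (u(x)·h(x))/|u(x)|` where `u(x) ≠ 0`,
and `0` where `u(x) = 0`. -/
theorem b_superposition_newton_diff
    (d : ℕ) (Ω : Set (EuclideanSpace ℝ (Fin d))) (hΩ : MeasurableSet Ω)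
    (hΩfin : volume Ω < ⊤)
    (ν : ℝ) (hν : 0 < ν)
    (φ : EuclideanSpace ℝ (Fin d) → ℝ) (hφm : Measurable φ)
    (hφν : ∀ᵐ x ∂(volume.restrict Ω), ν ≤ φ x)
    (p q : ℝ≥0∞) [Fact (1 ≤ p)] [Fact (1 ≤ q)]
    (h2q : 2 ≤ 2 * q) (hqp : 2 * q ≤ p) (hp : p ≠ ⊤) :
    ∃ (b : Lp (EuclideanSpace ℝ (Fin d)) p (volume.restrict Ω) →
          Lp ℝ q (volume.restrict Ω))
      (Gb : Lp (EuclideanSpace ℝ (Fin d)) p (volume.restrict Ω) →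
          (Lp (EuclideanSpace ℝ (Fin d)) p (volume.restrict Ω) →L[ℝ]
            Lp ℝ q (volume.restrict Ω))),
      (∀ u, ⇑(b u) =ᵐ[volume.restrict Ω] fun x => min 1 (max 0 (‖u x‖ - φ x))) ∧
      (∀ u h, ⇑(Gb u h) =ᵐ[volume.restrict Ω] fun x => Gbval (φ x) (u x) (h x)) ∧
      (∀ u, ∀ ε > 0, ∃ δ > 0, ∀ h, ‖h‖ < δ →
        ‖b (u + h) - b u - Gb (u + h) h‖ ≤ ε * ‖h‖) := by
  have hq1 : 1 ≤ q := Fact.out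
  have hq0 : q ≠ 0 := (one_pos.trans_le hq1).ne'
  have hqlt : q < p := by
    have hqt : q ≠ ⊤ := by
      rintro rfl
      simp [hp] at hqp
    refine lt_of_lt_of_le ?_ hqp
    rw [two_mul]
    exact ENNReal.lt_add_right hqt hq0
  have : IsFiniteMeasure (volume.restrict Ω) := ⟨by simpa using hΩfin⟩
  obtain ⟨s, hs0, hs, _⟩ := exists_holderTriple_of_lt hq0 hqlt
  set μ := volume.restrict Ω
  let b : Lp (EuclideanSpace ℝ (Fin d)) p μ → Lp ℝ q μ := fun u =>
    (memLp_clamp_s12 hφm (Lp.aestronglyMeasurable u)).toLp _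
  have hb : ∀ u, ⇑(b u) =ᵐ[μ] fun x => min 1 (max 0 (‖u x‖ - φ x)) := fun u =>
    MemLp.coeFn_toLp _
  refine ⟨b, GbvalCLM hp hqlt.le hφm, hb, coeFn_GbvalCLM hp hqlt.le hφm, fun u ε hε => ?_⟩
  have hrem : ∀ h, ⇑(b (u + h) - b u - GbvalCLM hp hqlt.le hφm (u + h) h) =ᵐ[μ]
      fun x => newtonRemainder (φ x) (u x) (h x) := fun h => by
    filter_upwards [Lp.coeFn_sub (b (u + h) - b u) (GbvalCLM hp hqlt.le hφm (u + h) h),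
      Lp.coeFn_sub (b (u + h)) (b u), hb (u + h), hb u, coeFn_GbvalCLM hp hqlt.le hφm (u + h) h,
      Lp.coeFn_add u h] with x h₁ h₂ h₃ h₄ h₅ h₆
    simp only [h₁, Pi.sub_apply, h₂, h₃, h₄, h₅, h₆, Pi.add_apply, newtonRemainder]
  by_contra! hcon
  choose h hh_lt hh_gt using fun n : ℕ => hcon (1 / ((n : ℝ) + 1)) Nat.one_div_pos_of_nat
  have hh : Tendsto h atTop (𝓝 0) :=
    squeeze_zero_norm (fun n => (hh_lt n).le) tendsto_one_div_add_atTop_nhds_zero_nat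
  obtain ⟨ns, -, hae⟩ := (tendstoInMeasure_of_tendsto_Lp hh).exists_seq_tendsto_ae
  have hmeas n := Lp.aestronglyMeasurable (h n)
  have hlim : Tendsto (fun n => eLpNorm
      (fun x => newtonRemainder (φ x) (u x) (h (ns n) x) / ‖h (ns n) x‖) s μ) atTop (𝓝 0) := by
    refine tendsto_eLpNorm_zero_of_bounded_s12 hs0 hs (fun n => ?_) 2 (fun n x => ?_) ?_
    · exact ((aestronglyMeasurable_newtonRemainder hφm (Lp.aestronglyMeasurable u)
        (hmeas _)).aemeasurable.div (hmeas _).norm.aemeasurable).aestronglyMeasurable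
    · rw [norm_div, norm_norm]
      exact div_le_of_le_mul₀ (norm_nonneg _) zero_le_two (abs_newtonRemainder_le _ _ _)
    · filter_upwards [hae, hφν, Lp.coeFn_zero (EuclideanSpace ℝ (Fin d)) p μ] with x hx hφx h0
      rw [h0] at hx
      exact (tendsto_newtonRemainder_div_norm (hν.trans_le hφx) (u x)).comp hx
  obtain ⟨n, hn⟩ := (hlim.eventually (eventually_lt_nhds (ENNReal.ofReal_pos.2 hε))).exists
  refine (hh_gt (ns n)).not_ge ?_
  rw [Lp.norm_def, Lp.norm_def, eLpNorm_congr_ae (hrem _), ← ENNReal.toReal_ofReal hε.le,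
    ← ENNReal.toReal_mul]
  refine ENNReal.toReal_mono (ENNReal.mul_ne_top ENNReal.ofReal_ne_top (Lp.eLpNorm_ne_top _)) ?_
  exact (eLpNorm_newtonRemainder_le (s := s) hφm (Lp.aestronglyMeasurable u) (hmeas _)).trans
    (mul_le_mul_left hn.le _)
end
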